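/- arXiv:2410.13251 — 2 statements merged into one kernel-verified Lean document; each statement's English description precedes it below -/
import Mathlib

section
/- The homogeneous networked system (𝒜, ℬ), with 𝒜 = I_N ⊗ A + L ⊗ (HC) and ℬ = Δ ⊗ B, is controllable if and only if for every λ ∈ ℂ the only matrix F ∈ ℂ^{N×n} satisfying Δᵀ F B = 0 and Lᵀ F H C = F(λ I_n − A) is F = 0. -/
open Matrix BigOperators

/-- Complexification of a real matrix (entrywise coercion `ℝ → ℂ`). -/
noncomputable def matC {m n : Type*} (M : Matrix m n ℝ) : Matrix m n ℂ :=
  M.map (fun x => (x : ℂ))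

/-- PBH eigenvector test for controllability of the pair `(A, B)`:
for every `λ ∈ ℂ`, the only row vector `v` with `v A = λ v` and `v B = 0` is `v = 0`. -/
def IsControllablePair {n p : Type*} [Fintype n] [Fintype p]
    (A : Matrix n n ℝ) (B : Matrix n p ℝ) : Prop :=
  ∀ (lam : ℂ) (v : n → ℂ), v ᵥ* matC A = lam • v → v ᵥ* matC B = 0 → v = 0

/-- PBH eigenvector test for observability of the pair `(C, A)`:
for every `λ ∈ ℂ`, the only column vector `v` with `A v = λ v` and `C v = 0` is `v = 0`. -/
def IsObservablePair {m n : Type*} [Fintype m] [Fintype n]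
    (C : Matrix m n ℝ) (A : Matrix n n ℝ) : Prop :=
  ∀ (lam : ℂ) (v : n → ℂ), matC A *ᵥ v = lam • v → matC C *ᵥ v = 0 → v = 0

/-- The set of complex eigenvalues of a real square matrix. -/
noncomputable def eigSet {n : Type*} [Fintype n] (M : Matrix n n ℝ) : Set ℂ :=
  {μ | ∃ v : n → ℂ, v ≠ 0 ∧ matC M *ᵥ v = μ • v}

/-- `v` is a left eigenvector of the real matrix `M` for the eigenvalue `μ`. -/
def IsLeftEig {n : Type*} [Fintype n] (M : Matrix n n ℝ) (μ : ℂ) (v : n → ℂ) : Prop :=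
  v ≠ 0 ∧ v ᵥ* matC M = μ • v

/-- The networked state matrix `𝒜`: the block matrix whose `(i,j)` block is
`A i + β i i • (H i * C i)` when `j = i` and `β i j • (H i * C j)` when `j ≠ i`. -/
noncomputable def netA (N : ℕ) (n : Fin N → ℕ) (m : ℕ)
    (A : ∀ i, Matrix (Fin (n i)) (Fin (n i)) ℝ)
    (H : ∀ i, Matrix (Fin (n i)) (Fin m) ℝ)
    (C : ∀ i, Matrix (Fin m) (Fin (n i)) ℝ)
    (β : Fin N → Fin N → ℝ) :
    Matrix (Σ i, Fin (n i)) (Σ i, Fin (n i)) ℝ :=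
  Matrix.blockDiagonal' A +
    Matrix.of (fun x y => β x.1 y.1 * (H x.1 * C y.1) x.2 y.2)

/-- The networked input matrix `ℬ = blockdiag(δ₁B₁, …, δ_N B_N)`. -/
noncomputable def netB (N : ℕ) (n p : Fin N → ℕ)
    (B : ∀ i, Matrix (Fin (n i)) (Fin (p i)) ℝ) (δ : Fin N → ℝ) :
    Matrix (Σ i, Fin (n i)) (Σ i, Fin (p i)) ℝ :=
  Matrix.blockDiagonal' (fun i => δ i • B i)

/-- The networked output matrix `𝒞 = blockdiag(C₁, …, C_N)`. -/
noncomputable def netC (N : ℕ) (n : Fin N → ℕ) (m : ℕ)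
    (C : ∀ i, Matrix (Fin m) (Fin (n i)) ℝ) :
    Matrix (Σ _ : Fin N, Fin m) (Σ i, Fin (n i)) ℝ :=
  Matrix.blockDiagonal' C

/-- The row vector `[0, …, 0, ζ, 0, …, 0]` with block `ζ` in position `i`. -/
def padded {N : ℕ} (n : Fin N → ℕ) (i : Fin N) (ζ : Fin (n i) → ℂ) :
    (Σ j, Fin (n j)) → ℂ :=
  fun x => if h : x.1 = i then ζ (Fin.cast (congrArg n h) x.2) else 0

open scoped Kronecker in
/-- A row vector indexed by pairs times a Kronecker product, as a product of matrices. -/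
theorem vecMul_matC_kronecker {k l a b : Type*} [Fintype k] [Fintype a]
    (F : Matrix k a ℂ) (L : Matrix k l ℝ) (M : Matrix a b ℝ) (x : l × b) :
    ((fun y : k × a => F y.1 y.2) ᵥ* matC (L ⊗ₖ M)) x =
      ((matC L)ᵀ * F * matC M) x.1 x.2 := by
  simp only [vecMul, dotProduct, Fintype.sum_prod_type, matC, Matrix.mul_apply,
    Matrix.map_apply, kroneckerMap_apply, transpose_apply, Finset.sum_mul]
  rw [Finset.sum_comm]
  refine Finset.sum_congr rfl fun _ _ => Finset.sum_congr rfl fun _ _ => ?_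
  push_cast
  ring

theorem matC_add {k l : Type*} (M M' : Matrix k l ℝ) : matC (M + M') = matC M + matC M' := by
  ext
  simp [matC]

theorem matC_one {k : Type*} [DecidableEq k] : matC (1 : Matrix k k ℝ) = 1 := by
  simp [matC]

open scoped Kronecker in
theorem homogeneous_controllability_matrix_equation
    (N n p m : ℕ)
    (A : Matrix (Fin n) (Fin n) ℝ) (B : Matrix (Fin n) (Fin p) ℝ)
    (C : Matrix (Fin m) (Fin n) ℝ) (H : Matrix (Fin n) (Fin m) ℝ)
    (L : Matrix (Fin N) (Fin N) ℝ) (δ : Fin N → ℝ)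
    (hδ : ∀ i, δ i = 0 ∨ δ i = 1) :
    IsControllablePair
        ((1 : Matrix (Fin N) (Fin N) ℝ) ⊗ₖ A + L ⊗ₖ (H * C))
        ((Matrix.diagonal δ) ⊗ₖ B) ↔
      ∀ (lam : ℂ) (F : Matrix (Fin N) (Fin n) ℂ),
        (matC (Matrix.diagonal δ))ᵀ * F * matC B = 0 →
        (matC L)ᵀ * F * matC (H * C) = F * (lam • (1 : Matrix (Fin n) (Fin n) ℂ) - matC A) →
        F = 0 := by
  have input_iff (F : Matrix (Fin N) (Fin n) ℂ) :
      (fun y : Fin N × Fin n => F y.1 y.2) ᵥ* matC (Matrix.diagonal δ ⊗ₖ B) = 0 ↔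
        (matC (Matrix.diagonal δ))ᵀ * F * matC B = 0 := by
    simp only [funext_iff, ← Matrix.ext_iff, vecMul_matC_kronecker, Prod.forall]
    rfl
  have state_iff (lam : ℂ) (F : Matrix (Fin N) (Fin n) ℂ) :
      (fun y : Fin N × Fin n => F y.1 y.2) ᵥ*
          matC ((1 : Matrix (Fin N) (Fin N) ℝ) ⊗ₖ A + L ⊗ₖ (H * C)) =
            lam • (fun y : Fin N × Fin n => F y.1 y.2) ↔
        (matC L)ᵀ * F * matC (H * C) =
          F * (lam • (1 : Matrix (Fin n) (Fin n) ℂ) - matC A) := by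
    rw [matC_add, vecMul_add, Matrix.mul_sub, Matrix.mul_smul, Matrix.mul_one,
      eq_sub_iff_add_eq']
    simp only [funext_iff, ← Matrix.ext_iff, Pi.add_apply, vecMul_matC_kronecker,
      Prod.forall, matC_one, transpose_one, Matrix.one_mul, Matrix.add_apply]
    rfl
  constructor
  · intro h lam F hB hA
    have hF := h lam (fun y => F y.1 y.2) ((state_iff lam F).2 hA) ((input_iff F).2 hB)
    ext i j
    exact congrFun hF (i, j)
  · intro h lam v hA hB
    have hF := h lam (Matrix.of fun i j => v (i, j)) ((input_iff _).1 hB)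
      ((state_iff lam _).1 hA)
    ext ⟨i, j⟩
    exact congrFun (congrFun hF i) j
end

section
/- Suppose the nodes of the networked system are connected in path topology P_N: β_{ij} = 0 unless j = i − 1 (in particular β_{ii} = 0 and node 1 has no incoming edges). If the networked system (𝒜, ℬ) is controllable, then the pair (A_1, B_1) is controllable. -/
open Matrix BigOperators

lemma padded_vecMul {N : ℕ} {n : Fin N → ℕ} {κ : Type*} (i : Fin N) (ζ : Fin (n i) → ℂ)
    (M : Matrix (Σ j, Fin (n j)) κ ℂ) :
    padded n i ζ ᵥ* M = ζ ᵥ* M.submatrix (fun k => ⟨i, k⟩) id := by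
  ext y
  simp only [vecMul, dotProduct, Fintype.sum_sigma, submatrix_apply, id]
  rw [Finset.sum_eq_single i]
  · simp [padded]
  · intro j _ hj
    simp [padded, hj]
  · simp

theorem path_topology_first_node_controllable
    (N : ℕ) (hN : 0 < N) (n p : Fin N → ℕ) (m : ℕ)
    (A : ∀ i, Matrix (Fin (n i)) (Fin (n i)) ℝ)
    (B : ∀ i, Matrix (Fin (n i)) (Fin (p i)) ℝ)
    (C : ∀ i, Matrix (Fin m) (Fin (n i)) ℝ)
    (H : ∀ i, Matrix (Fin (n i)) (Fin m) ℝ)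
    (β : Fin N → Fin N → ℝ) (δ : Fin N → ℝ)
    (hδ : ∀ i, δ i = 0 ∨ δ i = 1)
    (hpath : ∀ i j : Fin N, (j : ℕ) + 1 ≠ (i : ℕ) → β i j = 0)
    (hctrl : IsControllablePair (netA N n m A H C β) (netB N n p B δ)) :
    IsControllablePair (A ⟨0, hN⟩) (B ⟨0, hN⟩) := by
  generalize hi₀ : (⟨0, hN⟩ : Fin N) = i₀
  intro lam v hA hB
  have hβ : ∀ j, β i₀ j = 0 := fun j => hpath i₀ j (by simp [← hi₀])
  have hpad : padded n i₀ v = 0 := by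
    refine hctrl lam _ ?_ ?_
    · rw [padded_vecMul]
      ext ⟨j, l⟩
      by_cases hj : j = i₀
      · subst hj
        simpa [vecMul, dotProduct, matC, netA, hβ, padded] using congrFun hA l
      · simp [vecMul, dotProduct, matC, netA, hβ, padded, hj,
          blockDiagonal'_apply_ne _ _ _ (Ne.symm hj)]
    · rw [padded_vecMul]
      ext ⟨j, l⟩
      by_cases hj : j = i₀
      · subst hj
        have h := congrFun hB l
        simp only [vecMul, dotProduct, matC, map_apply, Pi.zero_apply] at h
        simp [vecMul, dotProduct, matC, netB]
        simp only [mul_left_comm _ (δ j : ℂ), ← Finset.mul_sum, h, mul_zero]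
      · simp [vecMul, dotProduct, matC, netB,
          blockDiagonal'_apply_ne _ _ _ (Ne.symm hj)]
  ext k
  simpa [padded] using congrFun hpad ⟨i₀, k⟩
end
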